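/- Let 𝒫 be a graded poset for which there exists an adequate local covering family and a global covering family 𝒦, and let b_n = rk H^n(𝒫;ℤ) be the Betti numbers of 𝒫. Then b_n ≤ b_n^𝒦 and b_n − b_{n−1} + … + (−1)^n b_0 ≤ b_n^𝒦 − b_{n−1}^𝒦 + … + (−1)^n b_0^𝒦 for every n ≥ 0. -/

import Mathlib

open Finset

/-- A graded poset (with the standing assumptions of Remark 2.5: the degree function is
order-reversing, adds one along preceding pairs, takes nonnegative values, and every
up-set is finite). -/
structure GradedPoset (P : Type) [PartialOrder P] : Type where
  deg : P → ℤ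
  deg_antitone : ∀ ⦃p q : P⦄, p ≤ q → deg q ≤ deg p
  deg_step : ∀ ⦃p q : P⦄, p < q → (∀ r, p ≤ r → r ≤ q → r = p ∨ r = q) → deg p = deg q + 1
  deg_nonneg : ∀ p, 0 ≤ deg p
  finite_up : ∀ p : P, {q : P | p ≤ q}.Finite

/-- A functor from a poset `P` to the category `Ab` of abelian groups. -/
structure PosetFunctor (P : Type) [PartialOrder P] : Type 1 where
  obj : P → Type
  grp : ∀ p, AddCommGroup (obj p)
  map : ∀ {p q : P}, p ≤ q → obj p →+ obj q
  map_id : ∀ (p : P) (x : obj p), map (le_refl p) x = x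
  map_comp : ∀ {p q r : P} (h₁ : p ≤ q) (h₂ : q ≤ r) (x : obj p),
    map h₂ (map h₁ x) = map (h₁.trans h₂) x

attribute [instance] PosetFunctor.grp

variable {P : Type} [PartialOrder P]

/-- A natural transformation between functors `P → Ab`. -/
structure PosetHom (F G : PosetFunctor P) : Type where
  app : ∀ p : P, F.obj p →+ G.obj p
  naturality : ∀ {p q : P} (h : p ≤ q) (x : F.obj p),
    G.map h (app p x) = app q (F.map h x)

/-- The constant functor with value `ℤ`. -/
def constZ (P : Type) [PartialOrder P] : PosetFunctor P where
  obj _ := ℤ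
  grp _ := inferInstance
  map _ := AddMonoidHom.id ℤ
  map_id _ _ := rfl
  map_comp _ _ _ := rfl

namespace PosetFunctor

/-- The inverse limit `lim F` of `F : P → Ab`, realized as the group of compatible
families (sections). -/
def sections (F : PosetFunctor P) : AddSubgroup (∀ p, F.obj p) where
  carrier := {x | ∀ (p q : P) (h : p ≤ q), F.map h (x p) = x q}
  zero_mem' := by intro p q h; simp
  add_mem' := by intro a b ha hb p q h; simp [map_add, ha p q h, hb p q h]
  neg_mem' := by intro a ha p q h; simp [ha p q h]

/-- The functor `F'` with `F'(p₀) = ∏_{p₀ ≤ p} F(p)`; a morphism `p₁ ≤ p₀` acts by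
sending the factor indexed by `p₁ ≤ p` identically to the factor indexed by `p₀ ≤ p`
when `p₀ ≤ p`, and by zero otherwise. -/
def prime (F : PosetFunctor P) : PosetFunctor P where
  obj p₀ := ∀ q : {q : P // p₀ ≤ q}, F.obj q.1
  grp _ := inferInstance
  map h := AddMonoidHom.mk' (fun x q => x ⟨q.1, h.trans q.2⟩) (fun _ _ => rfl)
  map_id _ _ := rfl
  map_comp _ _ _ := rfl

end PosetFunctor

/-- The subgroup `Ker_F(p₀) = ⋂_{p₀ < q} Ker (F(p₀ → q))`. -/
def kerAt (F : PosetFunctor P) (p₀ : P) : AddSubgroup (F.obj p₀) where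
  carrier := {x | ∀ (q : P) (h : p₀ < q), F.map h.le x = 0}
  zero_mem' := by intro q h; simp
  add_mem' := by intro a b ha hb q h; simp [map_add, ha q h, hb q h]
  neg_mem' := by intro a ha q h; simp [ha q h]

/-- `F` is `n`-condensed: `F(p) = 0` for `deg p < n` and `Ker_F(p) = 0` for `deg p > n`. -/
def IsCondensed (G : GradedPoset P) (F : PosetFunctor P) (n : ℕ) : Prop :=
  (∀ p : P, G.deg p < (n : ℤ) → ∀ x : F.obj p, x = 0) ∧
  (∀ p : P, (n : ℤ) < G.deg p → ∀ x ∈ kerAt F p, x = 0)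

/-- The set `(p₀ ↓ P)_n` of objects above `p₀` of degree `n`. -/
def degSet (G : GradedPoset P) (p₀ : P) (n : ℕ) : Set P :=
  {q : P | p₀ ≤ q ∧ G.deg q = (n : ℤ)}

/-- The functor `Ker'_F` (for an `n`-condensed functor `F`):
`Ker'_F(p₀) = ∏_{p ∈ (p₀↓P)_n} F(p)`. -/
def kerPrime (G : GradedPoset P) (F : PosetFunctor P) (n : ℕ) : PosetFunctor P where
  obj p₀ := ∀ q : degSet G p₀ n, F.obj q.1
  grp _ := inferInstance
  map h := AddMonoidHom.mk' (fun x q => x ⟨q.1, h.trans q.2.1, q.2.2⟩) (fun _ _ => rfl)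
  map_id _ _ := rfl
  map_comp _ _ _ := rfl

/-- The natural transformation `λ : F ⇒ Ker'_F` with components
`λ_{p₀} = ∏_{p ∈ (p₀↓P)_n} F(p₀ → p)`. -/
def lambdaNT (G : GradedPoset P) (F : PosetFunctor P) (n : ℕ) :
    PosetHom F (kerPrime G F n) where
  app p₀ := AddMonoidHom.mk' (fun x q => F.map q.2.1 x)
    (by intro a b; funext q; exact map_add _ a b)
  naturality := by
    intro p q h x
    funext r
    exact (F.map_comp h r.2.1 x).symm

/-! ### The cochain complex computing higher inverse limits -/

/-- Composable chains `p₀ ≤ p₁ ≤ … ≤ pₙ` in `P`. -/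
def ChainP (P : Type) [PartialOrder P] (n : ℕ) : Type :=
  {c : Fin (n + 1) → P // Monotone c}

/-- `n`-cochains of the cobar complex computing the derived functors of `lim` over `P`
with coefficients in `F`. -/
abbrev cochain (F : PosetFunctor P) (n : ℕ) : Type :=
  ∀ c : ChainP P n, F.obj (c.1 (Fin.last n))

/-- The `i`-th face of a chain. -/
def chainFace {n : ℕ} (i : Fin (n + 2)) (c : ChainP P (n + 1)) : ChainP P n :=
  ⟨c.1 ∘ i.succAbove, c.2.comp (Fin.strictMono_succAbove i).monotone⟩

/-- The differential of the cobar complex. -/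
noncomputable def cobarDiff (F : PosetFunctor P) (n : ℕ) : cochain F n →+ cochain F (n + 1) :=
  AddMonoidHom.mk'
    (fun ψ c => ∑ i : Fin (n + 2),
      ((-1 : ℤ) ^ (i : ℕ)) • F.map (c.2 (Fin.le_last (i.succAbove (Fin.last n))))
        (ψ (chainFace i c)))
    (by
      intro a b; funext c
      simp only [Pi.add_apply, map_add, smul_add]
      refine Eq.trans (Finset.sum_congr rfl fun i _ => ?_)
        (Finset.sum_add_distrib (M := F.obj (c.1 (Fin.last (n + 1)))))
      exact (congrArg (fun y => ((-1 : ℤ) ^ (i : ℕ)) • y)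
        ((F.map (c.2 (Fin.le_last (i.succAbove (Fin.last n))))).map_add
          (a (chainFace i c)) (b (chainFace i c)))).trans (smul_add _ _ _))

/-- Coboundaries of the cobar complex. -/
noncomputable def cobarCoboundaries (F : PosetFunctor P) : ∀ n : ℕ, AddSubgroup (cochain F n)
  | 0 => ⊥
  | n + 1 => (cobarDiff F n).range

/-- `H^n(P; F) = lim^n F`, the cohomology of `P` with coefficients in `F`, computed by
the cobar complex. -/
noncomputable def cohomologyOf (F : PosetFunctor P) (n : ℕ) : Type :=
  (cobarDiff F n).ker ⧸ ((cobarCoboundaries F n).addSubgroupOf (cobarDiff F n).ker)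

noncomputable instance (F : PosetFunctor P) (n : ℕ) : AddCommGroup (cohomologyOf F n) :=
  inferInstanceAs (AddCommGroup (_ ⧸ _))

/-- The `n`-th Betti number of `P` with coefficients in `F`: the rank of `H^n(P;F)`. -/
noncomputable def bettiOf (F : PosetFunctor P) (n : ℕ) : ℕ :=
  Module.finrank ℤ (cohomologyOf F n)

/-! ### Free functors, pure maps, local covering families -/

/-- A functor is free if all its values are finitely generated free abelian groups. -/
def IsFreeFunctor (F : PosetFunctor P) : Prop :=
  ∀ p : P, Module.Free ℤ (F.obj p) ∧ Module.Finite ℤ (F.obj p)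

/-- A map of abelian groups is pure if its cokernel is a free abelian group. -/
def IsPureHom {A B : Type} [AddCommGroup A] [AddCommGroup B] (f : A →+ B) : Prop :=
  Module.Free ℤ (B ⧸ f.range)

/-- Sections of `F` over a subset `S ⊆ P`, i.e. `lim_S F`. -/
def sectionsOnSet (F : PosetFunctor P) (S : Set P) : Set (∀ q : S, F.obj q.1) :=
  {x | ∀ (q r : S) (h : q.1 ≤ r.1), F.map h (x q) = x r}

/-- The restriction map `lim_{(p₀↓P)_*} F → ∏_{q ∈ S} F(q)` (for `S` a set of objects
strictly above `p₀`, realized by intersecting with `{q | p₀ < q}`). -/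
def limRestriction (F : PosetFunctor P) (p₀ : P) (S : Set P) :
    ↥(sectionsOnSet F {q : P | p₀ < q}) → ∀ q : ↥(S ∩ {q : P | p₀ < q}), F.obj q.1 :=
  fun x q => x.1 ⟨q.1, q.2.2⟩

/-- The map `F(p₀) → ∏_{q ∈ S} F(q)` (for `S` a set of objects above `p₀`, realized by
intersecting with `{q | p₀ ≤ q}`). -/
def detMap (F : PosetFunctor P) (p₀ : P) (S : Set P) :
    F.obj p₀ →+ ∀ q : ↥(S ∩ {q : P | p₀ ≤ q}), F.obj q.1 :=
  AddMonoidHom.mk' (fun x q => F.map q.2.2 x) (by intro a b; funext q; exact map_add _ a b)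

/-- A local covering family `𝒥 = {J_n^{p₀}}` (Definition 3.4). -/
def IsLCF (G : GradedPoset P) (J : P → ℕ → Set P) : Prop :=
  (∀ (p : P) (m : ℕ), J p m ⊆ degSet G p m) ∧
  (∀ (p : P) (m : ℕ), (m : ℤ) < G.deg p →
    (⋃ r ∈ J p (m + 1), degSet G r m) = degSet G p m) ∧
  (∀ (p : P) (m : ℕ), ∀ r ∈ J p (m + 1), J r m ⊆ J p m)

/-- `F` (an `n`-condensed free functor) is `𝒥`-determined (Definition 3.5). -/
def IsDetermined (G : GradedPoset P) (J : P → ℕ → Set P) (F : PosetFunctor P) (n : ℕ) :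
    Prop :=
  (∀ p₀ : P, (n : ℤ) + 1 < G.deg p₀ →
    Function.Injective (limRestriction F p₀ (J p₀ n)) ∧ IsPureHom (detMap F p₀ (J p₀ n))) ∧
  (∀ p₀ : P, G.deg p₀ = (n : ℤ) + 1 →
    IsPureHom (detMap F p₀ (J p₀ n)) ∧ Function.Injective (detMap F p₀ (J p₀ n)))

/-- The finite set `(p↓P)_n`. -/
noncomputable def degFinset (G : GradedPoset P) (p : P) (n : ℕ) : Finset P :=
  ((G.finite_up p).subset
    (show degSet G p n ⊆ {q : P | p ≤ q} from fun _ hq => hq.1)).toFinset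

/-- The numbers `R_n^{p₀}` (Definition 4.1). -/
noncomputable def Rnum (G : GradedPoset P) : ℕ → P → ℤ
  | 0, _ => 1
  | m + 1, p => (∑ q ∈ degFinset G p m, Rnum G m q) - Rnum G m p

/-- The finite set `J_n^p` (as a `Finset`, using finiteness of up-sets). -/
noncomputable def JFinset (G : GradedPoset P) (J : P → ℕ → Set P) (p : P) (n : ℕ) :
    Finset P :=
  ((G.finite_up p).inter_of_left (J p n)).toFinset

/-- Connectedness of a subset of a poset, viewed as a full subcategory. -/
def IsConnectedSet (S : Set P) : Prop :=
  S.Nonempty ∧ ∀ a b : S, Relation.ReflTransGen (fun x y : S => x.1 ≤ y.1 ∨ y.1 ≤ x.1) a b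

/-- An adequate local covering family (Definition 4.2). -/
def IsAdequate (G : GradedPoset P) (J : P → ℕ → Set P) : Prop :=
  IsLCF G J ∧
  (∀ p : P, 2 ≤ G.deg p → IsConnectedSet {q : P | p < q}) ∧
  (∀ (m : ℕ) (p : P), (m : ℤ) + 1 ≤ G.deg p →
    Rnum G m p = ∑ q ∈ JFinset G J p m, Rnum G m q)

/-! ### The global complex and global covering families -/

/-- Restriction of a product of abelian groups to a subset of the index set. -/
def restrictTo {ι : Type} {A : ι → Type} [∀ i, AddCommGroup (A i)] (S : Set ι) :
    (∀ i, A i) →+ ∀ i : S, A i.1 :=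
  AddMonoidHom.mk' (fun x i => x i.1) (fun _ _ => rfl)

open Classical in
/-- Extension by zero of a family indexed by a subset of the index set. -/
noncomputable def extendZero {ι : Type} {A : ι → Type} [∀ i, AddCommGroup (A i)]
    (S : Set ι) : (∀ i : S, A i.1) →+ ∀ i, A i :=
  AddMonoidHom.mk' (fun x i => if h : i ∈ S then x ⟨i, h⟩ else 0)
    (by intro a b; funext i; by_cases h : i ∈ S <;> simp [h])

/-- The map on full products induced by a natural transformation
`π : Ker'_F ⇒ F'` (the building block of the differential `d = ι ∘ ω`). -/
noncomputable def dhat (G : GradedPoset P) {F F' : PosetFunctor P} (n : ℕ)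
    (π : PosetHom (kerPrime G F n) F') : (∀ p : P, F.obj p) →+ ∀ p : P, F'.obj p :=
  AddMonoidHom.mk' (fun x p => π.app p (fun q => x q.1))
    (by intro a b; funext p; exact map_add (π.app p) _ _)

/-- The set `Ob_n(P)` of objects of degree `n`. -/
def obSet (G : GradedPoset P) (n : ℕ) : Set P := {p : P | G.deg p = (n : ℤ)}

/-- The differential `d_n = ι_{n+1} ∘ ω_{n+1} : ∏_{Ob_n} F_n(p) → ∏_{Ob_{n+1}} F_{n+1}(p)`. -/
noncomputable def obDiff (G : GradedPoset P) (F : ℕ → PosetFunctor P)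
    (π : ∀ n : ℕ, PosetHom (kerPrime G (F n) n) (F (n + 1))) (n : ℕ) :
    (∀ p : ↥(obSet G n), (F n).obj p.1) →+ ∀ p : ↥(obSet G (n + 1)), (F (n + 1)).obj p.1 :=
  (restrictTo (obSet G (n + 1))).comp ((dhat G n (π n)).comp (extendZero (obSet G n)))

/-- The composite `∏_{p ∈ Ob_n(P)∖K_n} F_n(p) → ∏_{p ∈ K_{n+1}} F_{n+1}(p)`
induced by the differential. -/
noncomputable def wMap (G : GradedPoset P) (F : ℕ → PosetFunctor P)
    (π : ∀ n : ℕ, PosetHom (kerPrime G (F n) n) (F (n + 1))) (K : ℕ → Set P) (n : ℕ) :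
    (∀ p : ↥(obSet G n \ K n), (F n).obj p.1) →+ ∀ p : ↥(K (n + 1)), (F (n + 1)).obj p.1 :=
  (restrictTo (K (n + 1))).comp ((dhat G n (π n)).comp (extendZero (obSet G n \ K n)))

/-- A global covering family (Definition 5.1). -/
def IsGCF (G : GradedPoset P) (F : ℕ → PosetFunctor P)
    (π : ∀ n : ℕ, PosetHom (kerPrime G (F n) n) (F (n + 1))) (K : ℕ → Set P) : Prop :=
  (∀ n : ℕ, K n ⊆ obSet G n) ∧
  (∀ n : ℕ, Function.Injective
    (fun (s : ↥(PosetFunctor.sections (F n))) => (fun p : ↥(K n) => s.1 p.1))) ∧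
  (∀ n : ℕ, IsPureHom (wMap G F π K n))

/-- `Ob_n(P)` as a `Finset` (given that each degree level is finite). -/
noncomputable def obFinset (G : GradedPoset P)
    (hfin : ∀ i : ℤ, {p : P | G.deg p = i}.Finite) (n : ℕ) : Finset P :=
  (hfin (n : ℤ)).toFinset

/-- `K_n` as a `Finset`. -/
noncomputable def KFinset (G : GradedPoset P)
    (hfin : ∀ i : ℤ, {p : P | G.deg p = i}.Finite) (K : ℕ → Set P) (n : ℕ) : Finset P :=
  ((hfin (n : ℤ)).inter_of_left (K n)).toFinset

/-- The Betti numbers `b_n^𝒦` of a global covering family (Definition 5.2). -/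
noncomputable def bettiK (G : GradedPoset P)
    (hfin : ∀ i : ℤ, {p : P | G.deg p = i}.Finite) (K : ℕ → Set P) : ℕ → ℤ
  | 0 => ∑ p ∈ KFinset G hfin K 0, Rnum G 0 p
  | n + 1 =>
      (∑ p ∈ KFinset G hfin K n, Rnum G n p) - (∑ p ∈ obFinset G hfin n, Rnum G n p) +
        ∑ p ∈ KFinset G hfin K (n + 1), Rnum G (n + 1) p

/-- The sequence of functors `F_0 = c_ℤ, F_1, F_2, …` of Proposition 4.3, together with
the connecting short exact sequences `0 → F_{n-1} → Ker'_{F_{n-1}} → F_n → 0` and all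
their properties. -/
structure CondensedSequence (G : GradedPoset P) (J : P → ℕ → Set P) : Type 1 where
  F : ℕ → PosetFunctor P
  pi : ∀ n : ℕ, PosetHom (kerPrime G (F n) n) (F (n + 1))
  F_zero : F 0 = constZ P
  pi_surj : ∀ (n : ℕ) (p : P), Function.Surjective ((pi n).app p)
  pi_ker : ∀ (n : ℕ) (p : P), ((pi n).app p).ker = ((lambdaNT G (F n) n).app p).range
  condensed : ∀ n : ℕ, IsCondensed G (F n) n
  free : ∀ n : ℕ, IsFreeFunctor (F n)
  determined : ∀ n : ℕ, IsDetermined G J (F n) n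
  rank_eq : ∀ (n : ℕ) (p : P), (n : ℤ) ≤ G.deg p →
    (Module.finrank ℤ ((F n).obj p) : ℤ) = Rnum G n p

/-! ### Simplex-like posets -/

/-- The poset `Δ_n` of faces of the standard `n`-dimensional simplex, ordered by
inclusion: faces are the nonempty subsets of the vertex set. -/
def SimplexPoset (n : ℕ) : Type := {s : Finset (Fin (n + 1)) // s.Nonempty}

instance (n : ℕ) : PartialOrder (SimplexPoset n) := Subtype.partialOrder _

/-- A poset `P` is simplex-like (with dimension function `d`) if for every `p` the
category `(P ↓ p)` is isomorphic to `Δ_{d p}`. -/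
def SimplexLike (P : Type) [PartialOrder P] (d : P → ℕ) : Prop :=
  ∀ p : P, Nonempty ({q : P // q ≤ p} ≃o SimplexPoset (d p))

/-! ### Helper lemmas -/

lemma alt_sum_zero {A : Type} [AddCommGroup A] (n : ℕ)
    (f : (Fin (n + 1) → Fin (n + 3)) → A) :
    ∑ i : Fin (n + 3), ∑ j : Fin (n + 2),
      ((-1 : ℤ) ^ (i : ℕ)) • ((-1 : ℤ) ^ (j : ℕ)) • f (i.succAbove ∘ j.succAbove) = 0 := by
  rw [← Fintype.sum_prod_type' (f := fun (i : Fin (n + 3)) (j : Fin (n + 2)) =>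
    ((-1 : ℤ) ^ (i : ℕ)) • ((-1 : ℤ) ^ (j : ℕ)) • f (i.succAbove ∘ j.succAbove))]
  refine Finset.sum_involution (fun x _ => (x.1.succAbove x.2, x.2.predAbove x.1)) ?_ ?_ ?_ ?_
  · rintro ⟨i, j⟩ _
    have h : (i.succAbove j).succAbove ∘ (j.predAbove i).succAbove
        = i.succAbove ∘ j.succAbove := by
      funext k
      exact Fin.succAbove_succAbove_succAbove_predAbove i j k
    simp only [h, smul_smul, ← pow_add]
    rw [Fin.neg_one_pow_succAbove_add_predAbove]
    simp
  · rintro ⟨i, j⟩ _ _ h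
    exact Fin.succAbove_ne i j (congrArg Prod.fst h)
  · intros; simp
  · rintro ⟨i, j⟩ _
    simp only [Fin.succAbove_succAbove_predAbove, Fin.predAbove_predAbove_succAbove]

lemma cobarDiff_apply (F : PosetFunctor P) (n : ℕ) (ψ : cochain F n) (c : ChainP P (n + 1)) :
    cobarDiff F n ψ c = ∑ i : Fin (n + 2),
      ((-1 : ℤ) ^ (i : ℕ)) • F.map (c.2 (Fin.le_last (i.succAbove (Fin.last n))))
        (ψ (chainFace i c)) := rfl

lemma cobarDiff_sq (F : PosetFunctor P) (n : ℕ) (ψ : cochain F n) :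
    cobarDiff F (n + 1) (cobarDiff F n ψ) = 0 := by
  classical
  funext c
  have key := alt_sum_zero n (fun e : Fin (n + 1) → Fin (n + 3) =>
    if he : Monotone e then
      F.map (c.2 (Fin.le_last (e (Fin.last n)))) (ψ ⟨c.1 ∘ e, c.2.comp he⟩) else 0)
  refine Eq.trans ?_ key
  rw [cobarDiff_apply]
  refine Finset.sum_congr rfl fun i _ => ?_
  rw [cobarDiff_apply, ← Finset.smul_sum]
  congr 1
  refine (map_sum (F.map _) _ _).trans ?_
  refine Finset.sum_congr rfl fun j _ => ?_
  have he : Monotone (i.succAbove ∘ j.succAbove) :=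
    (Fin.strictMono_succAbove i).monotone.comp (Fin.strictMono_succAbove j).monotone
  rw [dif_pos he]
  refine (map_zsmul (F.map _) _ _).trans ?_
  congr 1
  exact F.map_comp _ _ _

/-- The map of cochains induced by a natural transformation. -/
def cmap {F F' : PosetFunctor P} (η : PosetHom F F') (n : ℕ) : cochain F n →+ cochain F' n :=
  AddMonoidHom.mk' (fun ψ c => η.app _ (ψ c)) (by
    intro a b; funext c; exact map_add (η.app _) _ _)

lemma cmap_comm {F F' : PosetFunctor P} (η : PosetHom F F') (n : ℕ) (ψ : cochain F n) :
    cobarDiff F' n (cmap η n ψ) = cmap η (n + 1) (cobarDiff F n ψ) := by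
  funext c
  change _ = η.app _ (∑ i : Fin (n + 2),
      ((-1 : ℤ) ^ (i : ℕ)) • F.map (c.2 (Fin.le_last (i.succAbove (Fin.last n))))
        (ψ (chainFace i c)))
  rw [map_sum, cobarDiff_apply]
  refine Finset.sum_congr rfl fun i _ => ?_
  refine Eq.trans ?_ (map_zsmul (η.app _) _ _).symm
  congr 1
  exact η.naturality _ _

lemma snake_equiv {A0 A1 A2 B0 B1 B2 C0 C1 : Type} [AddCommGroup A0] [AddCommGroup A1]
    [AddCommGroup A2] [AddCommGroup B0] [AddCommGroup B1] [AddCommGroup B2]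
    [AddCommGroup C0] [AddCommGroup C1]
    (dA0 : A0 →+ A1) (dA1 : A1 →+ A2) (dB0 : B0 →+ B1) (dB1 : B1 →+ B2) (dC0 : C0 →+ C1)
    (i0 : A0 →+ B0) (i1 : A1 →+ B1) (i2 : A2 →+ B2) (p0 : B0 →+ C0) (p1 : B1 →+ C1)
    (hi0 : ∀ x, dB0 (i0 x) = i1 (dA0 x)) (hi1 : ∀ x, dB1 (i1 x) = i2 (dA1 x))
    (hp0 : ∀ x, dC0 (p0 x) = p1 (dB0 x))
    (inj1 : Function.Injective i1) (inj2 : Function.Injective i2)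
    (ex0 : p0.ker = i0.range) (ex1 : p1.ker = i1.range)
    (surj0 : Function.Surjective p0)
    (hB : ∀ x, dB1 (dB0 x) = 0) (exB : ∀ y, dB1 y = 0 → ∃ x, dB0 x = y) :
    Nonempty ((dA1.ker ⧸ (dA0.range.addSubgroupOf dA1.ker)) ≃+
      (dC0.ker ⧸ ((dB0.ker.map p0).addSubgroupOf dC0.ker))) := by
  have hW : ∀ w : (dC0.comp p0).ker, ∃ a : A1, i1 a = dB0 w.1 := by
    intro w
    have h : dB0 w.1 ∈ p1.ker := by
      rw [AddMonoidHom.mem_ker, ← hp0]; exact w.2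
    rw [ex1] at h
    exact h
  choose g hg using hW
  have hgk : ∀ w, dA1 (g w) = 0 := by
    intro w
    apply inj2
    rw [← hi1, hg, hB, map_zero]
  let f : (dC0.comp p0).ker →+ dC0.ker :=
    AddMonoidHom.mk' (fun w => ⟨p0 w.1, w.2⟩) (by
      intro a b; apply Subtype.ext; exact map_add p0 _ _)
  let g' : (dC0.comp p0).ker →+ dA1.ker :=
    AddMonoidHom.mk' (fun w => ⟨g w, hgk w⟩) (by
      intro a b; apply Subtype.ext; apply inj1
      change i1 (g (a + b)) = i1 (g a + g b)
      rw [map_add, hg, hg, hg]; exact map_add dB0 _ _)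
  let φ1 := (QuotientAddGroup.mk' ((dB0.ker.map p0).addSubgroupOf dC0.ker)).comp f
  let φ2 := (QuotientAddGroup.mk' (dA0.range.addSubgroupOf dA1.ker)).comp g'
  have s1 : Function.Surjective φ1 := by
    refine (QuotientAddGroup.mk'_surjective _).comp ?_
    rintro ⟨c, hc⟩
    obtain ⟨b, rfl⟩ := surj0 c
    exact ⟨⟨b, hc⟩, rfl⟩
  have s2 : Function.Surjective φ2 := by
    refine (QuotientAddGroup.mk'_surjective _).comp ?_
    rintro ⟨a, ha⟩
    have h : dB1 (i1 a) = 0 := by rw [hi1, (AddMonoidHom.mem_ker).1 ha, map_zero]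
    obtain ⟨b, hb⟩ := exB _ h
    have hm : i1 a ∈ p1.ker := by rw [ex1]; exact ⟨a, rfl⟩
    refine ⟨⟨b, ?_⟩, ?_⟩
    · change dC0 (p0 b) = 0
      rw [hp0, hb]; exact hm
    · apply Subtype.ext
      apply inj1
      exact (hg _).trans hb
  have hk : φ2.ker = φ1.ker := by
    ext w
    have e1 : w ∈ φ1.ker ↔ p0 w.1 ∈ dB0.ker.map p0 :=
      (QuotientAddGroup.eq_zero_iff (f w)).trans AddSubgroup.mem_addSubgroupOf
    have e2 : w ∈ φ2.ker ↔ g w ∈ dA0.range :=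
      (QuotientAddGroup.eq_zero_iff (g' w)).trans AddSubgroup.mem_addSubgroupOf
    rw [e1, e2]
    constructor
    · rintro ⟨a, ha⟩
      refine ⟨w.1 - i0 a, ?_, ?_⟩
      · change dB0 _ = 0
        rw [map_sub, hi0, ha, hg, sub_self]
      · have : i0 a ∈ p0.ker := by rw [ex0]; exact ⟨a, rfl⟩
        rw [map_sub, (AddMonoidHom.mem_ker).1 this, sub_zero]
    · rintro ⟨b, hb, hbw⟩
      have : w.1 - b ∈ p0.ker := by
        rw [AddMonoidHom.mem_ker, map_sub, hbw, sub_self]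
      rw [ex0] at this
      obtain ⟨a, ha⟩ := this
      refine ⟨a, ?_⟩
      apply inj1
      rw [← hi0, ha, map_sub, hg, (AddMonoidHom.mem_ker).1 hb, sub_zero]
  exact ⟨(QuotientAddGroup.quotientKerEquivOfSurjective φ2 s2).symm.trans
    ((QuotientAddGroup.quotientAddEquivOfEq hk).trans
      (QuotientAddGroup.quotientKerEquivOfSurjective φ1 s1))⟩

/-- Append an element on top of a chain. -/
def chainSnoc {n : ℕ} (c : ChainP P n) (q : P) (h : c.1 (Fin.last n) ≤ q) : ChainP P (n + 1) :=
  ⟨Fin.snoc (α := fun _ => P) c.1 q, by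
    intro a b hab
    induction b using Fin.lastCases with
    | last =>
      induction a using Fin.lastCases with
      | last => exact le_rfl
      | cast a => simpa using (c.2 (Fin.le_last a)).trans h
    | cast b =>
      induction a using Fin.lastCases with
      | last => exact absurd hab (not_le.2 (Fin.castSucc_lt_last b))
      | cast a => simpa using c.2 (Fin.castSucc_le_castSucc_iff.1 hab)⟩

lemma chainSnoc_last {n : ℕ} (c : ChainP P n) (q : P) (h : c.1 (Fin.last n) ≤ q) :
    (chainSnoc c q h).1 (Fin.last (n + 1)) = q := by
  simp [chainSnoc]

lemma chainFace_snoc_last {n : ℕ} (c : ChainP P n) (q : P) (h : c.1 (Fin.last n) ≤ q) :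
    chainFace (Fin.last (n + 1)) (chainSnoc c q h) = c := by
  apply Subtype.ext
  funext k
  simp [chainFace, chainSnoc]

lemma chainFace_snoc_castSucc {n : ℕ} (c : ChainP P (n + 1)) (q : P)
    (h : c.1 (Fin.last (n + 1)) ≤ q) (i : Fin (n + 2)) :
    chainFace i.castSucc (chainSnoc c q h) =
      chainSnoc (chainFace i c) q ((c.2 (Fin.le_last _)).trans h) := by
  apply Subtype.ext
  funext k
  induction k using Fin.lastCases with
  | last => simp [chainFace, chainSnoc]
  | cast k => simp [chainFace, chainSnoc]

lemma kerPrime_congr (G : GradedPoset P) (F : PosetFunctor P) (m n : ℕ)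
    (ψ : cochain (kerPrime G F m) n) {c c' : ChainP P n} (hc : c = c') (q : P)
    (h : q ∈ degSet G (c.1 (Fin.last n)) m) (h' : q ∈ degSet G (c'.1 (Fin.last n)) m) :
    ψ c ⟨q, h⟩ = ψ c' ⟨q, h'⟩ := by
  subst hc; rfl

lemma kerPrime_diff_apply (G : GradedPoset P) (F : PosetFunctor P) (m n : ℕ)
    (ψ : cochain (kerPrime G F m) n) (c : ChainP P (n + 1)) (q : P)
    (h : q ∈ degSet G (c.1 (Fin.last (n + 1))) m) :
    cobarDiff (kerPrime G F m) n ψ c ⟨q, h⟩ = ∑ i : Fin (n + 2), ((-1 : ℤ) ^ (i : ℕ)) •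
      ψ (chainFace i c) ⟨q, (c.2 (Fin.le_last _)).trans h.1, h.2⟩ := by
  rw [cobarDiff_apply]
  refine (Finset.sum_apply (M := fun r : degSet G (c.1 (Fin.last (n + 1))) m => F.obj r.1)
    _ _ _).trans ?_
  rfl

lemma kerPrime_exact (G : GradedPoset P) (F : PosetFunctor P) (m n : ℕ)
    (ψ : cochain (kerPrime G F m) (n + 1)) (hψ : cobarDiff (kerPrime G F m) (n + 1) ψ = 0) :
    ∃ θ : cochain (kerPrime G F m) n, cobarDiff (kerPrime G F m) n θ = ψ := by
  let θ : cochain (kerPrime G F m) n := fun c q =>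
    ψ (chainSnoc c q.1 q.2.1) ⟨q.1, (chainSnoc_last c q.1 q.2.1).le, q.2.2⟩
  refine ⟨((-1 : ℤ) ^ (n + 1)) • θ, ?_⟩
  rw [map_zsmul]
  funext c
  funext ⟨q, hq⟩
  have h0 : cobarDiff (kerPrime G F m) (n + 1) ψ (chainSnoc c q hq.1)
      ⟨q, (chainSnoc_last c q hq.1).le, hq.2⟩ = 0 := by rw [hψ]; rfl
  have hd := kerPrime_diff_apply G F m (n + 1) ψ (chainSnoc c q hq.1) q
    ⟨(chainSnoc_last c q hq.1).le, hq.2⟩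
  replace h0 := hd.symm.trans h0
  rw [Fin.sum_univ_castSucc] at h0
  have hθ := kerPrime_diff_apply G F m n θ c q hq
  have e1 : ψ (chainFace (Fin.last (n + 1 + 1)) (chainSnoc c q hq.1))
      ⟨q, ((chainSnoc c q hq.1).2 (Fin.le_last _)).trans (chainSnoc_last c q hq.1).le, hq.2⟩
      = ψ c ⟨q, hq⟩ :=
    kerPrime_congr G F m (n + 1) ψ (chainFace_snoc_last c q hq.1) q _ _
  have e2 : ∀ i : Fin (n + 2), ψ (chainFace i.castSucc (chainSnoc c q hq.1))
      ⟨q, ((chainSnoc c q hq.1).2 (Fin.le_last _)).trans (chainSnoc_last c q hq.1).le, hq.2⟩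
      = θ (chainFace i c) ⟨q, (c.2 (Fin.le_last _)).trans hq.1, hq.2⟩ := fun i =>
    kerPrime_congr G F m (n + 1) ψ (chainFace_snoc_castSucc c q hq.1 i) q _ _
  rw [e1] at h0
  simp only [e2, Fin.val_castSucc, Fin.val_last] at h0
  rw [← hθ] at h0
  change ((-1 : ℤ) ^ (n + 1)) • (cobarDiff (kerPrime G F m) n θ c ⟨q, hq⟩) = ψ c ⟨q, hq⟩
  rw [eq_neg_of_add_eq_zero_left h0, smul_neg, smul_smul, ← pow_add, ← neg_smul]
  have : -(-1 : ℤ) ^ (n + 1 + (n + 1 + 1)) = 1 := by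
    have : n + 1 + (n + 1 + 1) = 2 * (n + 1) + 1 := by ring
    rw [this, pow_succ, pow_mul]; simp
  rw [this, one_smul]

lemma lambda_inj (G : GradedPoset P) (F : PosetFunctor P) (m : ℕ) (hF : IsCondensed G F m) :
    ∀ p : P, Function.Injective ((lambdaNT G F m).app p) := by
  suffices H : ∀ (N : ℕ) (p : P), {q : P | p ≤ q}.ncard ≤ N → ∀ x : F.obj p,
      (lambdaNT G F m).app p x = 0 → x = 0 by
    intro p
    rw [injective_iff_map_eq_zero]
    exact H _ p le_rfl
  intro N
  induction N with
  | zero =>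
    intro p hp
    have : {q : P | p ≤ q} = ∅ := (Set.ncard_eq_zero (G.finite_up p)).1 (Nat.le_zero.1 hp)
    exact absurd (show p ∈ {q : P | p ≤ q} from le_rfl) (by rw [this]; simp)
  | succ N ih =>
    intro p hp x hx
    have hx' : ∀ q (hq : q ∈ degSet G p m), F.map hq.1 x = 0 := fun q hq => congrFun hx ⟨q, hq⟩
    rcases lt_trichotomy (G.deg p) (m : ℤ) with h | h | h
    · exact hF.1 p h x
    · have := hx' p ⟨le_rfl, h⟩
      rwa [F.map_id] at this
    · refine hF.2 p h x ?_
      intro q hq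
      refine ih q ?_ _ ?_
      · have hss : {r : P | q ≤ r} ⊂ {r : P | p ≤ r} := by
          refine ⟨fun r hr => hq.le.trans hr, fun hcon => ?_⟩
          exact absurd (hcon (show p ∈ {r : P | p ≤ r} from le_rfl)) (not_le_of_gt hq)
        have := Set.ncard_lt_ncard hss (G.finite_up p)
        omega
      · funext r
        refine (F.map_comp hq.le r.2.1 x).trans ?_
        exact hx' r.1 ⟨hq.le.trans r.2.1, r.2.2⟩

lemma cmap_inj {F F' : PosetFunctor P} (η : PosetHom F F') (h : ∀ p, Function.Injective (η.app p))
    (n : ℕ) : Function.Injective (cmap η n) := by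
  intro a b hab
  funext c
  exact h _ (congrFun hab c)

lemma cmap_surj {F F' : PosetFunctor P} (η : PosetHom F F')
    (h : ∀ p, Function.Surjective (η.app p)) (n : ℕ) : Function.Surjective (cmap η n) := by
  intro y
  choose x hx using fun c => h _ (y c)
  exact ⟨x, funext hx⟩

lemma cmap_exact {F F' F'' : PosetFunctor P} (η : PosetHom F F') (ζ : PosetHom F' F'')
    (h : ∀ p, (ζ.app p).ker = (η.app p).range) (n : ℕ) :
    (cmap ζ n).ker = (cmap η n).range := by
  ext y
  constructor
  · intro hy
    have : ∀ c, ∃ x, η.app _ x = y c := by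
      intro c
      have hm : y c ∈ (ζ.app (c.1 (Fin.last n))).ker := congrFun hy c
      rw [h] at hm
      exact hm
    choose x hx using this
    exact ⟨x, funext hx⟩
  · rintro ⟨x, rfl⟩
    funext c
    have hm : η.app _ (x c) ∈ (ζ.app (c.1 (Fin.last n))).ker := by
      rw [h]; exact ⟨_, rfl⟩
    exact hm

lemma step_equiv {G : GradedPoset P} {J : P → ℕ → Set P} (S : CondensedSequence G J) (m i : ℕ) :
    Nonempty (cohomologyOf (S.F m) (i + 1) ≃+
      ((cobarDiff (S.F (m + 1)) i).ker ⧸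
        (((cobarDiff (kerPrime G (S.F m) m) i).ker.map (cmap (S.pi m) i)).addSubgroupOf
          (cobarDiff (S.F (m + 1)) i).ker))) :=
  snake_equiv (cobarDiff (S.F m) i) (cobarDiff (S.F m) (i + 1))
    (cobarDiff (kerPrime G (S.F m) m) i) (cobarDiff (kerPrime G (S.F m) m) (i + 1))
    (cobarDiff (S.F (m + 1)) i)
    (cmap (lambdaNT G (S.F m) m) i) (cmap (lambdaNT G (S.F m) m) (i + 1))
    (cmap (lambdaNT G (S.F m) m) (i + 2)) (cmap (S.pi m) i) (cmap (S.pi m) (i + 1))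
    (cmap_comm _ _) (cmap_comm _ _) (cmap_comm _ _)
    (cmap_inj _ (lambda_inj G _ m (S.condensed m)) _)
    (cmap_inj _ (lambda_inj G _ m (S.condensed m)) _)
    (cmap_exact _ _ (S.pi_ker m) _) (cmap_exact _ _ (S.pi_ker m) _)
    (cmap_surj _ (S.pi_surj m) _) (cobarDiff_sq _ _) (kerPrime_exact G _ m i)

lemma betti_shift {G : GradedPoset P} {J : P → ℕ → Set P} (S : CondensedSequence G J)
    (m k : ℕ) : bettiOf (S.F m) (k + 2) = bettiOf (S.F (m + 1)) (k + 1) := by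
  obtain ⟨e⟩ := step_equiv S m (k + 1)
  have h : (cobarDiff (kerPrime G (S.F m) m) (k + 1)).ker.map (cmap (S.pi m) (k + 1))
      = cobarCoboundaries (S.F (m + 1)) (k + 1) := by
    ext y
    constructor
    · rintro ⟨x, hx, rfl⟩
      obtain ⟨z, rfl⟩ := kerPrime_exact G _ m k x hx
      exact ⟨cmap (S.pi m) k z, cmap_comm _ _ _⟩
    · rintro ⟨x, rfl⟩
      obtain ⟨z, rfl⟩ := cmap_surj _ (S.pi_surj m) _ x
      exact ⟨cobarDiff _ k z, cobarDiff_sq _ _ _, (cmap_comm _ _ _).symm⟩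
  rw [h] at e
  exact e.toIntLinearEquiv.finrank_eq

lemma betti_shift_all {G : GradedPoset P} {J : P → ℕ → Set P} (S : CondensedSequence G J)
    (k : ℕ) : ∀ m, bettiOf (S.F m) (k + 1) = bettiOf (S.F (m + k)) 1 := by
  induction k with
  | zero => intro m; rfl
  | succ k ih =>
    intro m
    rw [betti_shift, ih (m + 1)]
    congr 2
    omega

/-- Zero-dimensional cocycles are compatible families. -/
noncomputable def zeroCocycleEquiv (F : PosetFunctor P) :
    (cobarDiff F 0).ker ≃+ PosetFunctor.sections F where
  toFun ψ := ⟨fun p => ψ.1 ⟨fun _ => p, monotone_const⟩, by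
    intro p q h
    have hc : Monotone (![p, q] : Fin 2 → P) := by
      intro a b hab
      fin_cases a <;> fin_cases b <;> simp_all
    have h0 : cobarDiff F 0 ψ.1 ⟨![p, q], hc⟩ = 0 := by
      rw [(AddMonoidHom.mem_ker).1 ψ.2]; rfl
    have aux : ∀ (c : ChainP P 0) (r : P) (hr : c = ⟨fun _ => r, monotone_const⟩)
        (h1 : c.1 (Fin.last 0) ≤ q) (h2 : r ≤ q),
        F.map h1 (ψ.1 c) = F.map h2 (ψ.1 ⟨fun _ => r, monotone_const⟩) := by
      intro c r hr h1 h2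
      subst hr; rfl
    replace h0 := (cobarDiff_apply F 0 ψ.1 ⟨![p, q], hc⟩).symm.trans h0
    rw [Fin.sum_univ_two] at h0
    have e0 := aux (chainFace 0 ⟨![p, q], hc⟩) q
      (Subtype.ext (by funext k; fin_cases k; rfl)) le_rfl le_rfl
    have e1 := aux (chainFace 1 ⟨![p, q], hc⟩) p
      (Subtype.ext (by funext k; fin_cases k; rfl)) h h
    rw [F.map_id] at e0
    have h0' : ((-1 : ℤ) ^ 0) • (ψ.1 ⟨fun _ => q, monotone_const⟩ : F.obj q) +
        ((-1 : ℤ) ^ 1) • F.map h (ψ.1 ⟨fun _ => p, monotone_const⟩) = 0 := by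
      rw [← e0, ← e1]; exact h0
    rw [pow_zero, one_smul, pow_one, neg_smul, one_smul, ← sub_eq_add_neg, sub_eq_zero] at h0'
    exact h0'.symm⟩
  invFun s := ⟨fun c => s.1 (c.1 (Fin.last 0)), by
    funext c
    rw [cobarDiff_apply]
    have : ∀ i : Fin 2, F.map (c.2 (Fin.le_last (i.succAbove (Fin.last 0))))
        (s.1 ((chainFace i c).1 (Fin.last 0))) = s.1 (c.1 (Fin.last 1)) := fun i => s.2 _ _ _
    rw [Fin.sum_univ_two]
    refine (congrArg₂ (fun a b => ((-1 : ℤ) ^ (0 : ℕ)) • a + ((-1 : ℤ) ^ (1 : ℕ)) • b)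
      (this 0) (this 1)).trans ?_
    simp⟩
  left_inv ψ := by
    apply Subtype.ext
    funext c
    have : ∃ p : P, c = ⟨fun _ => p, monotone_const⟩ :=
      ⟨c.1 0, Subtype.ext (by funext k; fin_cases k; rfl)⟩
    obtain ⟨p, rfl⟩ := this
    rfl
  right_inv s := rfl
  map_add' a b := rfl

/-- Sections of `Ker'_F` are families indexed by the objects of degree `m`. -/
def kerPrimeSections (G : GradedPoset P) (F : PosetFunctor P) (m : ℕ) :
    PosetFunctor.sections (kerPrime G F m) ≃+ (∀ p : obSet G m, F.obj p.1) where
  toFun s p := s.1 p.1 ⟨p.1, le_rfl, p.2⟩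
  invFun y := ⟨fun p q => y ⟨q.1, q.2.2⟩, fun p q h => rfl⟩
  left_inv s := by
    apply Subtype.ext
    funext p q
    exact (congrFun (s.2 p q.1 q.2.1) ⟨q.1, le_rfl, q.2.2⟩).symm
  right_inv y := rfl
  map_add' a b := rfl

lemma rank_nullity_add {X Y : Type} [AddCommGroup X] [AddCommGroup Y] [Module.Finite ℤ X]
    (f : X →+ Y) :
    Module.finrank ℤ f.range + Module.finrank ℤ f.ker = Module.finrank ℤ X := by
  have h := Submodule.finrank_quotient_add_finrank (LinearMap.ker f.toIntLinearMap)
  rw [f.toIntLinearMap.quotKerEquivRange.finrank_eq] at h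
  exact h

lemma rank_four {X Y Z : Type} [AddCommGroup X] [AddCommGroup Y] [AddCommGroup Z]
    [Module.Finite ℤ X] [Module.Finite ℤ Y] (j : Z →+ X) (r : X →+ Y)
    (hj : Function.Injective j) (hr : r.ker = j.range) :
    Module.finrank ℤ (Y ⧸ r.range) + Module.finrank ℤ X =
      Module.finrank ℤ Y + Module.finrank ℤ Z := by
  have h1 := rank_nullity_add r
  have h2 := rank_nullity_add (QuotientAddGroup.mk' r.range)
  have h3 : Module.finrank ℤ (QuotientAddGroup.mk' r.range).range =
      Module.finrank ℤ (Y ⧸ r.range) := by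
    rw [AddMonoidHom.range_eq_top.2 (QuotientAddGroup.mk'_surjective _)]
    exact (AddSubgroup.topEquiv (G := Y ⧸ r.range)).toIntLinearEquiv.finrank_eq
  rw [QuotientAddGroup.ker_mk'] at h2
  rw [hr] at h1
  have h4 : Module.finrank ℤ j.range = Module.finrank ℤ Z :=
    (AddMonoidHom.ofInjective hj).toIntLinearEquiv.finrank_eq.symm
  omega

section ranks
variable {G : GradedPoset P} {J : P → ℕ → Set P} (S : CondensedSequence G J)
  (hfin : ∀ i : ℤ, {p : P | G.deg p = i}.Finite)

lemma finite_prod (T : Set P) (m : ℕ) (hT : T ⊆ obSet G m)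
    (hfin : ∀ i : ℤ, {p : P | G.deg p = i}.Finite) (U : Finset P) (hU : ∀ p, p ∈ U ↔ p ∈ T) :
    Module.Finite ℤ (∀ p : T, (S.F m).obj p.1) ∧
    (Module.finrank ℤ (∀ p : T, (S.F m).obj p.1) : ℤ) = ∑ p ∈ U, Rnum G m p := by
  have hTf : T.Finite := (hfin m).subset hT
  have : Fintype T := hTf.fintype
  have hfr : ∀ p : T, Module.Free ℤ ((S.F m).obj p.1) := fun p => (S.free m p.1).1
  have hfi : ∀ p : T, Module.Finite ℤ ((S.F m).obj p.1) := fun p => (S.free m p.1).2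
  refine ⟨Module.Finite.pi, ?_⟩
  have h := Module.finrank_pi_fintype ℤ (M := fun p : T => (S.F m).obj p.1)
  have h' : Module.finrank ℤ (∀ p : T, (S.F m).obj p.1) =
    ∑ p : T, Module.finrank ℤ ((S.F m).obj p.1) := h
  rw [h', Finset.sum_subtype U hU]
  push_cast
  exact Finset.sum_congr rfl fun p _ => S.rank_eq m p.1 (le_of_eq (hT p.2).symm)

lemma sections_rank_le (K : ℕ → Set P) (hK : IsGCF G S.F S.pi K) (m : ℕ) :
    Module.Finite ℤ (cobarDiff (S.F m) 0).ker ∧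
    (Module.finrank ℤ (cobarDiff (S.F m) 0).ker : ℤ) ≤ ∑ p ∈ KFinset G hfin K m, Rnum G m p := by
  obtain ⟨hf, hr⟩ := finite_prod S (K m) m (hK.1 m) hfin (KFinset G hfin K m) (by
    intro p
    simp only [KFinset, Set.Finite.mem_toFinset, Set.mem_inter_iff]
    exact ⟨fun h => h.2, fun h => ⟨hK.1 m h, h⟩⟩)
  let f : (cobarDiff (S.F m) 0).ker →+ (∀ p : K m, (S.F m).obj p.1) :=
    (AddMonoidHom.mk' (fun (s : PosetFunctor.sections (S.F m)) => (fun p : K m => s.1 p.1))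
      (fun _ _ => rfl)).comp (zeroCocycleEquiv (S.F m)).toAddMonoidHom
  have hinj : Function.Injective f.toIntLinearMap :=
    (hK.2.1 m).comp (zeroCocycleEquiv (S.F m)).injective
  refine ⟨Module.Finite.of_injective _ hinj, ?_⟩
  rw [← hr]
  exact_mod_cast LinearMap.finrank_le_finrank_of_injective hinj

lemma betti_eq (K : ℕ → Set P) (hK : IsGCF G S.F S.pi K) (m : ℕ) :
    (bettiOf (S.F 0) (m + 1) : ℤ) = Module.finrank ℤ (cobarDiff (S.F (m + 1)) 0).ker +
      Module.finrank ℤ (cobarDiff (S.F m) 0).ker - ∑ p ∈ obFinset G hfin m, Rnum G m p := by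
  rw [betti_shift_all, zero_add]
  obtain ⟨e⟩ := step_equiv S m 0
  have he : bettiOf (S.F m) 1 = _ := e.toIntLinearEquiv.finrank_eq
  obtain ⟨hf, hr⟩ := finite_prod S (obSet G m) m subset_rfl hfin (obFinset G hfin m) (by
    intro p
    simp only [obFinset, Set.Finite.mem_toFinset]
    rfl)
  have eX : (cobarDiff (kerPrime G (S.F m) m) 0).ker ≃+ (∀ p : obSet G m, (S.F m).obj p.1) :=
    (zeroCocycleEquiv _).trans (kerPrimeSections G (S.F m) m)
  have fX : Module.Finite ℤ (cobarDiff (kerPrime G (S.F m) m) 0).ker :=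
    Module.Finite.equiv eX.symm.toIntLinearEquiv
  have rX := eX.toIntLinearEquiv.finrank_eq
  have fY := (sections_rank_le S hfin K hK (m + 1)).1
  let j : (cobarDiff (S.F m) 0).ker →+ (cobarDiff (kerPrime G (S.F m) m) 0).ker :=
    AddMonoidHom.mk' (fun x => ⟨cmap (lambdaNT G (S.F m) m) 0 x.1, by
      rw [AddMonoidHom.mem_ker, cmap_comm, (AddMonoidHom.mem_ker).1 x.2, map_zero]⟩) (by
      intro a b; apply Subtype.ext; exact map_add (cmap _ 0) _ _)
  let r : (cobarDiff (kerPrime G (S.F m) m) 0).ker →+ (cobarDiff (S.F (m + 1)) 0).ker :=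
    AddMonoidHom.mk' (fun x => ⟨cmap (S.pi m) 0 x.1, by
      rw [AddMonoidHom.mem_ker, cmap_comm, (AddMonoidHom.mem_ker).1 x.2, map_zero]⟩) (by
      intro a b; apply Subtype.ext; exact map_add (cmap _ 0) _ _)
  have hlam := lambda_inj G _ m (S.condensed m)
  have hj : Function.Injective j := by
    intro a b hab
    apply Subtype.ext
    exact cmap_inj _ hlam 0 (congrArg Subtype.val hab)
  have hex := cmap_exact _ _ (S.pi_ker m) 0
  have hrj : r.ker = j.range := by
    ext x
    constructor
    · intro hx
      have hx' : x.1 ∈ (cmap (S.pi m) 0).ker := congrArg Subtype.val hx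
      rw [hex] at hx'
      obtain ⟨z, hz⟩ := hx'
      refine ⟨⟨z, ?_⟩, Subtype.ext hz⟩
      apply cmap_inj _ hlam 1
      rw [← cmap_comm, hz, map_zero]
      exact x.2
    · rintro ⟨z, rfl⟩
      apply Subtype.ext
      have : cmap (lambdaNT G (S.F m) m) 0 z.1 ∈ (cmap (S.pi m) 0).ker := by
        rw [hex]; exact ⟨_, rfl⟩
      exact this
  have hN : ((cobarDiff (kerPrime G (S.F m) m) 0).ker.map (cmap (S.pi m) 0)).addSubgroupOf
      (cobarDiff (S.F (m + 1)) 0).ker = r.range := by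
    ext y
    rw [AddSubgroup.mem_addSubgroupOf]
    constructor
    · rintro ⟨x, hx, hxy⟩
      exact ⟨⟨x, hx⟩, Subtype.ext hxy⟩
    · rintro ⟨x, rfl⟩
      exact ⟨x.1, x.2, rfl⟩
  have h4 := rank_four j r hj hrj
  rw [hN] at he
  rw [← he, rX] at h4
  rw [← hr]
  omega

lemma betti_zero (F : PosetFunctor P) :
    bettiOf F 0 = Module.finrank ℤ (cobarDiff F 0).ker := by
  have h : (cobarCoboundaries F 0).addSubgroupOf (cobarDiff F 0).ker = ⊥ := by
    simp [cobarCoboundaries]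
  have e : cohomologyOf F 0 ≃+ (cobarDiff F 0).ker :=
    (QuotientAddGroup.quotientAddEquivOfEq h).trans QuotientAddGroup.quotientBot
  exact e.toIntLinearEquiv.finrank_eq

end ranks

lemma alt_sum_succ (b : ℕ → ℤ) (n : ℕ) :
    ∑ i ∈ Finset.range (n + 1 + 1), (-1 : ℤ) ^ i * b (n + 1 - i) =
      b (n + 1) - ∑ i ∈ Finset.range (n + 1), (-1 : ℤ) ^ i * b (n - i) := by
  rw [Finset.sum_range_succ', sub_eq_add_neg, ← Finset.sum_neg_distrib, add_comm]
  congr 1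
  · simp
  · refine Finset.sum_congr rfl fun i _ => ?_
    rw [Nat.add_sub_add_right, pow_succ]; ring

/-- The alternating sums of two sequences with the given form differ by `k n - l n`. -/
lemma alt_sum_diff (b c l k a : ℕ → ℤ) (hb0 : b 0 = l 0) (hc0 : c 0 = k 0)
    (hb : ∀ n, b (n + 1) = l (n + 1) + l n - a n) (hc : ∀ n, c (n + 1) = k n - a n + k (n + 1))
    (n : ℕ) :
    ∑ i ∈ Finset.range (n + 1), (-1 : ℤ) ^ i * c (n - i) -
      ∑ i ∈ Finset.range (n + 1), (-1 : ℤ) ^ i * b (n - i) = k n - l n := by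
  induction n with
  | zero => simp [hb0, hc0]
  | succ n ih =>
    rw [alt_sum_succ, alt_sum_succ, hb, hc]
    linarith

/-- **Proposition 5.4.** Let `𝒫` be a graded poset for which there exists an adequate
local covering family and a global covering family `𝒦`, and let `b_n = rk H^n(𝒫;ℤ)` be
the Betti numbers of `𝒫`. Then `b_n ≤ b_n^𝒦` and
`b_n − b_{n−1} + … + (−1)^n b_0 ≤ b_n^𝒦 − b_{n−1}^𝒦 + … + (−1)^n b_0^𝒦` for all `n ≥ 0`. -/
theorem prop_5_4 {P : Type} [PartialOrder P] (G : GradedPoset P) (J : P → ℕ → Set P)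
    (hJ : IsAdequate G J) (S : CondensedSequence G J)
    (hfin : ∀ i : ℤ, {p : P | G.deg p = i}.Finite)
    (K : ℕ → Set P) (hK : IsGCF G S.F S.pi K) (n : ℕ) :
    ((bettiOf (constZ P) n : ℤ) ≤ bettiK G hfin K n) ∧
    (∑ i ∈ Finset.range (n + 1), (-1 : ℤ) ^ i * (bettiOf (constZ P) (n - i) : ℤ)) ≤
      ∑ i ∈ Finset.range (n + 1), (-1 : ℤ) ^ i * bettiK G hfin K (n - i) := by
  have hb : ∀ m, (bettiOf (constZ P) (m + 1) : ℤ) =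
      Module.finrank ℤ (cobarDiff (S.F (m + 1)) 0).ker +
      Module.finrank ℤ (cobarDiff (S.F m) 0).ker - ∑ p ∈ obFinset G hfin m, Rnum G m p := by
    intro m
    rw [← S.F_zero]
    exact betti_eq S hfin K hK m
  have hb0 : (bettiOf (constZ P) 0 : ℤ) = Module.finrank ℤ (cobarDiff (S.F 0) 0).ker := by
    rw [← S.F_zero, betti_zero]
  have hl := fun m => (sections_rank_le S hfin K hK m).2
  constructor
  · cases n with
    | zero => rw [hb0]; exact hl 0
    | succ m =>
      rw [hb, bettiK]
      linarith [hl m, hl (m + 1)]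
  · have := alt_sum_diff (fun m => (bettiOf (constZ P) m : ℤ)) (bettiK G hfin K)
      (fun m => (Module.finrank ℤ (cobarDiff (S.F m) 0).ker : ℤ))
      (fun m => ∑ p ∈ KFinset G hfin K m, Rnum G m p)
      (fun m => ∑ p ∈ obFinset G hfin m, Rnum G m p) hb0 rfl hb (fun _ => rfl) n
    have h2 := hl n
    linarith
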